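/- Let G be a CGS, A ⊆ Ξ, n ≥ 0, D a deterministic parity automaton over alphabet S^{n+1}, and 𝔄 the alternating parity automaton over alphabet S^n constructed from G, A and D as described. For all p_1, …, p_n ∈ S^ω: if ⊗(p_1, …, p_n) ∈ L(𝔄), then there exists a set F_A of strategies for the agents in A such that every p ∈ out(G, s°, F_A) satisfies ⊗(p_1, …, p_n, p) ∈ L(D), where s° = p_n(0) if n ≥ 1 and s° = s0 if n = 0. -/

import Mathlib

/-- A concurrent game structure over states `S`, agents `Agent`, moves `M`
and atomic propositions `AP`. -/
structure CGS (S Agent M AP : Type) where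
  s0 : S
  δ : S → (Agent → M) → S
  Lab : S → Set AP

/-- The history `p(0) ⋯ p(i)`. -/
def hist {S : Type} (p : ℕ → S) (i : ℕ) : List S :=
  (List.range (i + 1)).map p

/-- `p ∈ out(G, s, F)`: outcomes from `s` when the agents in `A` follow the
strategies `F`. -/
def InOut {S Agent M : Type} (δ : S → (Agent → M) → S) (A : Set Agent)
    (F : Agent → List S → M) (s : S) (p : ℕ → S) : Prop :=
  p 0 = s ∧ ∀ i, ∃ σ : Agent → M, δ (p i) σ = p (i + 1) ∧
    ∀ ξ ∈ A, σ ξ = F ξ (hist p i)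

/-- Positive boolean formulas over `X`. -/
inductive PosBool (X : Type) where
  | var : X → PosBool X
  | and : PosBool X → PosBool X → PosBool X
  | or : PosBool X → PosBool X → PosBool X

/-- Satisfaction of a positive boolean formula by a set `B ⊆ X`. -/
def PosBool.Sat {X : Type} (B : Set X) : PosBool X → Prop
  | .var x => x ∈ B
  | .and φ ψ => φ.Sat B ∧ ψ.Sat B
  | .or φ ψ => φ.Sat B ∨ ψ.Sat B

/-- Finite disjunction `⋁_{i : ι} f i` as a positive boolean formula. -/
noncomputable def PosBool.bigOr {X ι : Type} [Fintype ι] [Nonempty ι]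
    (f : ι → PosBool X) : PosBool X :=
  ((Finset.univ : Finset ι).toList.map f).foldr PosBool.or (f (Classical.arbitrary ι))

/-- Finite conjunction `⋀_{i : ι} f i` as a positive boolean formula. -/
noncomputable def PosBool.bigAnd {X ι : Type} [Fintype ι] [Nonempty ι]
    (f : ι → PosBool X) : PosBool X :=
  ((Finset.univ : Finset ι).toList.map f).foldr PosBool.and (f (Classical.arbitrary ι))

/-- `cs` satisfies the parity condition: the minimal color occurring
infinitely often in `cs` is even. -/
def ParityAccept (cs : ℕ → ℕ) : Prop :=
  ∃ d, Even d ∧ (∀ N, ∃ k ≥ N, cs k = d) ∧ ∀ d' < d, ∃ N, ∀ k ≥ N, cs k ≠ d'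

/-- An alternating parity automaton over alphabet `Alph` with states `Q`. -/
structure APA (Alph Q : Type) where
  q0 : Q
  ρ : Q → Alph → PosBool Q
  c : Q → ℕ

/-- The node of depth `k` along the infinite branch `b`. -/
def branchPrefix (b : ℕ → ℕ) (k : ℕ) : List ℕ :=
  (List.range k).map b

/-- `(T, r)` is a run of the APA `A` on the word `w`. -/
def APA.IsRun {Alph Q : Type} (A : APA Alph Q) (w : ℕ → Alph)
    (T : Set (List ℕ)) (r : List ℕ → Q) : Prop :=
  ([] ∈ T) ∧
  (∀ τ ∈ T, ∀ τ' : List ℕ, τ' <+: τ → τ' ∈ T) ∧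
  r [] = A.q0 ∧
  ∀ τ ∈ T, PosBool.Sat {q | ∃ m : ℕ, τ ++ [m] ∈ T ∧ r (τ ++ [m]) = q}
    (A.ρ (r τ) (w τ.length))

/-- The run `(T, r)` is accepting: along every infinite branch of `T`, the
minimal color occurring infinitely often is even. -/
def APA.AcceptingRun {Alph Q : Type} (A : APA Alph Q) (w : ℕ → Alph)
    (T : Set (List ℕ)) (r : List ℕ → Q) : Prop :=
  A.IsRun w T r ∧
  ∀ b : ℕ → ℕ, (∀ k, branchPrefix b k ∈ T) →
    ParityAccept (fun k => A.c (r (branchPrefix b k)))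

/-- `w ∈ L(A)` for the APA `A`. -/
def APA.Accepts {Alph Q : Type} (A : APA Alph Q) (w : ℕ → Alph) : Prop :=
  ∃ T r, A.AcceptingRun w T r

/-- A deterministic parity automaton over alphabet `Alph` with states `Q`. -/
structure DPA (Alph Q : Type) where
  q0 : Q
  ρ : Q → Alph → Q
  c : Q → ℕ

/-- The (unique) run of the DPA `D` on the word `w`. -/
def DPA.run {Alph Q : Type} (D : DPA Alph Q) (w : ℕ → Alph) : ℕ → Q
  | 0 => D.q0
  | t + 1 => D.ρ (D.run w t) (w t)

/-- `w ∈ L(D)` for the DPA `D`. -/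
def DPA.Accepts {Alph Q : Type} (D : DPA Alph Q) (w : ℕ → Alph) : Prop :=
  ParityAccept (fun t => D.c (D.run w t))

/-- The combined global move vector `σ + σ'` of a partial move vector `σ` for
the agents in `A` and a partial move vector `σ'` for the agents in `Aᶜ`. -/
def combine {Agent M : Type} [Fintype Agent] [DecidableEq Agent] (A : Finset Agent)
    (σ : {ξ // ξ ∈ A} → M) (σ' : {ξ // ξ ∈ Aᶜ} → M) : Agent → M :=
  fun ξ => if h : ξ ∈ A then σ ⟨ξ, h⟩ else σ' ⟨ξ, Finset.mem_compl.mpr h⟩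

/-- `s° = s_n` (the last component of `v`) if `n ≥ 1`, and `s° = s0` if `n = 0`. -/
def sCirc {S : Type} (s0 : S) {n : ℕ} (v : Fin n → S) : S :=
  if h : 0 < n then v ⟨n - 1, Nat.sub_lt h Nat.one_pos⟩ else s0

/-- The alternating parity automaton over alphabet `Sⁿ` constructed from the
CGS `G`, the agent set `A`, and the deterministic parity automaton `D` over
alphabet `S^{n+1}`: disjunctive choice of moves for the agents in `A`,
conjunctive treatment of the moves of the adversarial agents. -/
noncomputable def constructAPA {S Agent M AP Q : Type}
    [Fintype Agent] [DecidableEq Agent] [Fintype M] [Nonempty M]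
    (G : CGS S Agent M AP) (A : Finset Agent) {n : ℕ}
    (D : DPA (Fin (n + 1) → S) Q) : APA (Fin n → S) ((S × Q) ⊕ Unit) where
  q0 := Sum.inr ()
  ρ := fun q v =>
    match q with
    | Sum.inr _ =>
        PosBool.bigOr (fun σ : {ξ // ξ ∈ A} → M =>
          PosBool.bigAnd (fun σ' : {ξ // ξ ∈ Aᶜ} → M =>
            PosBool.var (Sum.inl
              (G.δ (sCirc G.s0 v) (combine A σ σ'),
               D.ρ D.q0 (Fin.snoc v (sCirc G.s0 v))))))
    | Sum.inl (s, q) =>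
        PosBool.bigOr (fun σ : {ξ // ξ ∈ A} → M =>
          PosBool.bigAnd (fun σ' : {ξ // ξ ∈ Aᶜ} → M =>
            PosBool.var (Sum.inl
              (G.δ s (combine A σ σ'), D.ρ q (Fin.snoc v s)))))
  c := fun q =>
    match q with
    | Sum.inl (_, q) => D.c q
    | Sum.inr _ => 0

theorem PosBool.sat_bigOr {X ι : Type} [Fintype ι] [Nonempty ι] {B : Set X}
    {f : ι → PosBool X} : (PosBool.bigOr f).Sat B ↔ ∃ i, (f i).Sat B := by
  have key : ∀ (l : List ι) (φ : PosBool X),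
      ((l.map f).foldr PosBool.or φ).Sat B ↔ (∃ i ∈ l, (f i).Sat B) ∨ φ.Sat B := by
    intro l φ
    induction l with
    | nil => simp
    | cons a l ih => simp [PosBool.Sat, ih, or_assoc]
  rw [PosBool.bigOr, key]
  simp only [Finset.mem_toList, Finset.mem_univ, true_and]
  exact ⟨fun h => h.elim id fun h => ⟨_, h⟩, Or.inl⟩

theorem PosBool.sat_bigAnd {X ι : Type} [Fintype ι] [Nonempty ι] {B : Set X}
    {f : ι → PosBool X} : (PosBool.bigAnd f).Sat B ↔ ∀ i, (f i).Sat B := by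
  have key : ∀ (l : List ι) (φ : PosBool X),
      ((l.map f).foldr PosBool.and φ).Sat B ↔ (∀ i ∈ l, (f i).Sat B) ∧ φ.Sat B := by
    intro l φ
    induction l with
    | nil => simp
    | cons a l ih => simp [PosBool.Sat, ih, and_assoc]
  rw [PosBool.bigAnd, key]
  simp only [Finset.mem_toList, Finset.mem_univ, true_imp_iff]
  exact ⟨And.left, fun h => ⟨h, h _⟩⟩

theorem ParityAccept.congr_eventually {cs cs' : ℕ → ℕ} (h : ParityAccept cs) (N₀ : ℕ)
    (heq : ∀ k ≥ N₀, cs k = cs' k) : ParityAccept cs' := by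
  obtain ⟨d, hd, hinf, hfin⟩ := h
  refine ⟨d, hd, fun N => ?_, fun d' hd' => ?_⟩
  · obtain ⟨k, hk, hkd⟩ := hinf (max N N₀)
    exact ⟨k, le_of_max_le_left hk, by rw [← heq k (le_of_max_le_right hk), hkd]⟩
  · obtain ⟨N, hN⟩ := hfin d' hd'
    refine ⟨max N N₀, fun k hk => ?_⟩
    rw [← heq k (le_of_max_le_right hk)]
    exact hN k (le_of_max_le_left hk)

theorem combine_restrict {Agent M : Type} [Fintype Agent] [DecidableEq Agent] (A : Finset Agent)
    (σ : Agent → M) : combine A (fun ξ => σ ξ) (fun ξ => σ ξ) = σ := by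
  funext ξ
  simp [combine]

theorem hist_succ {S : Type} (p : ℕ → S) (i : ℕ) :
    hist p (i + 1) = hist p i ++ [p (i + 1)] := by
  simp [hist, List.range_succ]

theorem branchPrefix_succ (b : ℕ → ℕ) (k : ℕ) :
    branchPrefix b (k + 1) = branchPrefix b k ++ [b k] := by
  simp [branchPrefix, List.range_succ]

/-- The pair of a state of `G` and a state of `D` that a state of the constructed automaton
stands for when it reads the letter `v`; the initial state stands for `(s°, q0)`. -/
def decodeState {S Agent M AP Q : Type} (G : CGS S Agent M AP) {n : ℕ}
    (D : DPA (Fin (n + 1) → S) Q) (v : Fin n → S) : (S × Q) ⊕ Unit → S × Q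
  | Sum.inl x => x
  | Sum.inr _ => (sCirc G.s0 v, D.q0)

theorem sat_constructAPA {S Agent M AP Q : Type}
    [Fintype Agent] [DecidableEq Agent] [Fintype M] [Nonempty M]
    {G : CGS S Agent M AP} {A : Finset Agent} {n : ℕ} {D : DPA (Fin (n + 1) → S) Q}
    {B : Set ((S × Q) ⊕ Unit)} {q : (S × Q) ⊕ Unit} {v : Fin n → S} :
    ((constructAPA G A D).ρ q v).Sat B ↔
      ∃ σ : {ξ // ξ ∈ A} → M, ∀ σ' : {ξ // ξ ∈ Aᶜ} → M,
        Sum.inl (G.δ (decodeState G D v q).1 (combine A σ σ'),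
          D.ρ (decodeState G D v q).2 (Fin.snoc v (decodeState G D v q).1)) ∈ B := by
  rcases q with ⟨s, q⟩ | u <;>
    simp only [constructAPA, decodeState, PosBool.sat_bigOr, PosBool.sat_bigAnd, PosBool.Sat]

/-- If the constructed APA accepts the zipping `⊗(p_1, …, p_n)`, then the
agents in `A` have strategies such that every outcome `p` from `s°` satisfies
`⊗(p_1, …, p_n, p) ∈ L(D)`. -/
theorem apa_accepts_implies_strategy {S Agent M AP Q : Type}
    [Fintype S] [Fintype Agent] [Nonempty Agent] [DecidableEq Agent]
    [Fintype M] [Nonempty M] [Fintype AP] [Fintype Q]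
    (G : CGS S Agent M AP) (A : Finset Agent) (n : ℕ)
    (D : DPA (Fin (n + 1) → S) Q)
    (ps : Fin n → ℕ → S)
    (hacc : (constructAPA G A D).Accepts (fun t j => ps j t)) :
    ∃ F : Agent → List S → M,
      ∀ p : ℕ → S, InOut G.δ (↑A) F (sCirc G.s0 (fun j => ps j 0)) p →
        D.Accepts (fun t => Fin.snoc (fun j => ps j t) (p t)) := by
  classical
  obtain ⟨T, r, ⟨hroot, -, hr0, hsat⟩, hbranch⟩ := hacc
  let w : ℕ → Fin n → S := fun t j => ps j t
  let dec : List ℕ → S × Q := fun τ => decodeState G D (w τ.length) (r τ)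
  let Succ : List ℕ → S → ℕ → Prop := fun τ s m =>
    τ ++ [m] ∈ T ∧ r (τ ++ [m]) =
      Sum.inl (s, D.ρ (dec τ).2 (Fin.snoc (α := fun _ => S) (w τ.length) (dec τ).1))
  have hmove : ∀ τ, ∃ σ : {ξ // ξ ∈ A} → M, τ ∈ T → ∀ σ' : {ξ // ξ ∈ Aᶜ} → M,
      ∃ m, Succ τ (G.δ (dec τ).1 (combine A σ σ')) m := by
    intro τ
    by_cases hτ : τ ∈ T
    · obtain ⟨σ, hσ⟩ := sat_constructAPA.1 (hsat τ hτ)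
      exact ⟨σ, fun _ => hσ⟩
    · exact ⟨Classical.arbitrary _, fun h => absurd h hτ⟩
  choose move hmove using hmove
  have hpick : ∀ τ s, ∃ m, (∃ m', Succ τ s m') → Succ τ s m := fun τ s => by
    by_cases h : ∃ m', Succ τ s m'
    · exact h.imp fun m hm _ => hm
    · exact ⟨0, fun h' => absurd h' h⟩
  choose pick hpick using hpick
  let node : List S → List ℕ := fun h => h.tail.foldl (fun τ s => τ ++ [pick τ s]) []
  refine ⟨fun ξ h => if hξ : ξ ∈ A then move (node h) ⟨ξ, hξ⟩ else Classical.arbitrary M,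
    fun p ⟨hp0, hp⟩ => ?_⟩
  have hnode_zero : node (hist p 0) = [] := rfl
  have hnode_succ : ∀ k, node (hist p (k + 1)) =
      node (hist p k) ++ [pick (node (hist p k)) (p (k + 1))] := by
    intro k
    have hne : hist p k ≠ [] := by simp [hist]
    simp only [node, hist_succ, List.tail_append_of_ne_nil hne, List.foldl_append,
      List.foldl_cons, List.foldl_nil]
  let b : ℕ → ℕ := fun k => pick (node (hist p k)) (p (k + 1))
  have hb : ∀ k, branchPrefix b k = node (hist p k) := by
    intro k
    induction k with
    | zero => rfl
    | succ k ih => rw [branchPrefix_succ, ih, hnode_succ]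
  have hlen : ∀ k, (node (hist p k)).length = k := fun k => by
    rw [← hb, branchPrefix, List.length_map, List.length_range]
  let run : ℕ → Q := D.run (fun t => Fin.snoc (fun j => ps j t) (p t))
  have hstep : ∀ k, node (hist p k) ∈ T → dec (node (hist p k)) = (p k, run k) →
      node (hist p (k + 1)) ∈ T ∧ r (node (hist p (k + 1))) = Sum.inl (p (k + 1), run (k + 1)) := by
    intro k hT hdec
    obtain ⟨σ, hδ, hσ⟩ := hp k
    have hcomb : combine A (move (node (hist p k))) (fun ξ => σ ξ) = σ := by
      have hres : move (node (hist p k)) = fun ξ => σ ξ.1 := by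
        funext ξ
        simp [hσ ξ ξ.2]
      rw [hres, combine_restrict]
    have hex := hmove _ hT (fun ξ => σ ξ)
    rw [hcomb, hdec, hδ] at hex
    have hs := hpick _ _ hex
    simp only [Succ] at hs
    rw [hdec, hlen, ← hnode_succ] at hs
    exact hs
  have hinv : ∀ k, node (hist p k) ∈ T ∧ dec (node (hist p k)) = (p k, run k) := by
    intro k
    induction k with
    | zero =>
      refine ⟨hroot, ?_⟩
      simp only [dec, hnode_zero, hr0, hp0]
      rfl
    | succ k ih =>
      obtain ⟨hT, hr⟩ := hstep k ih.1 ih.2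
      exact ⟨hT, by simp only [dec, hr, decodeState]⟩
  refine (hbranch b fun k => hb k ▸ (hinv k).1).congr_eventually 1 fun k hk => ?_
  obtain ⟨k, rfl⟩ := Nat.exists_eq_add_of_le' hk
  simp only [hb, (hstep k (hinv k).1 (hinv k).2).2]
  rfl
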